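/- arXiv:1403.1708 — 3 statements merged into one kernel-verified Lean document; each statement's English description precedes it below -/
import Mathlib

section
/- For every nonnegative integer k there exists a constant C > 0 such that for all x ∈ ℝ and all H > 0, |φ^{(k)}(x+H) − φ^{(k)}(x)| ≤ C H ( e^{−|x|} 𝟙_{|x| > 2H} + (1/(1+H)) 𝟙_{|x| ≤ 2H} ). -/
open MeasureTheory Real

/-- `φ(x) = (1/(2π)) ∫_ℝ exp(−ω⁴/2) e^{iωx} dω`; since `φ` is real-valued and even,
it equals its cosine-transform expression. -/
noncomputable def phi (x : ℝ) : ℝ :=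
  (1 / (2 * Real.pi)) * ∫ ω : ℝ, Real.exp (-(ω ^ 4) / 2) * Real.cos (ω * x)

theorem Polynomial.exists_norm_eval_le_exp (p : Polynomial ℂ) :
    ∃ C : ℝ, 0 ≤ C ∧ ∀ z : ℂ, ‖p.eval z‖ ≤ C * Real.exp ‖z‖ := by
  induction p using Polynomial.induction_on' with
  | add p q hp hq =>
    obtain ⟨C, hC, hp⟩ := hp
    obtain ⟨D, hD, hq⟩ := hq
    refine ⟨C + D, by positivity, fun z => ?_⟩
    rw [Polynomial.eval_add, add_mul]
    exact (norm_add_le _ _).trans (add_le_add (hp z) (hq z))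
  | monomial n a =>
    refine ⟨‖a‖ * n.factorial, by positivity, fun z => ?_⟩
    rw [Polynomial.eval_monomial, norm_mul, norm_pow, mul_assoc]
    gcongr
    have h := Real.pow_div_factorial_le_exp ‖z‖ (norm_nonneg z) n
    rwa [div_le_iff₀ (by positivity), mul_comm] at h

/-- The integrand `p(z) exp(-z⁴/2) exp(ixz)` for complex frequency `z`. -/
noncomputable def quarticKernel (p : Polynomial ℂ) (x : ℝ) (z : ℂ) : ℂ :=
  p.eval z * Complex.exp (-z ^ 4 / 2 + Complex.I * z * x)

/-- The integral of `quarticKernel p x` along the horizontal line `im z = a`. -/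
noncomputable def quarticIntegral (p : Polynomial ℂ) (a x : ℝ) : ℂ :=
  ∫ ω : ℝ, quarticKernel p x (ω + a * Complex.I)

theorem continuous_quarticKernel (p : Polynomial ℂ) (x : ℝ) :
    Continuous (quarticKernel p x) := by
  unfold quarticKernel
  fun_prop

theorem norm_quarticKernel (p : Polynomial ℂ) (x : ℝ) (z : ℂ) :
    ‖quarticKernel p x z‖ = ‖p.eval z‖ *
      Real.exp (-(z.re ^ 4 - 6 * z.re ^ 2 * z.im ^ 2 + z.im ^ 4) / 2 - z.im * x) := by
  rw [quarticKernel, norm_mul, Complex.norm_exp]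
  congr 2
  obtain ⟨r, s⟩ := z
  simp [pow_succ]
  ring

theorem exists_norm_quarticKernel_le (p : Polynomial ℂ) {A : ℝ} (hA : 0 ≤ A) (X : ℝ) :
    ∃ C : ℝ, ∀ (x : ℝ) (z : ℂ), |x| ≤ X → |z.im| ≤ A →
      ‖quarticKernel p x z‖ ≤ C * Real.exp (-1 * z.re ^ 2) := by
  obtain ⟨C, hC, hp⟩ := p.exists_norm_eval_le_exp
  refine ⟨C * Real.exp (1 + A + A * X + (3 * A ^ 2 + 2) ^ 2 / 2), fun x z hx hz => ?_⟩
  rw [norm_quarticKernel]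
  calc _ ≤ C * Real.exp ‖z‖ *
        Real.exp (-(z.re ^ 4 - 6 * z.re ^ 2 * z.im ^ 2 + z.im ^ 4) / 2 - z.im * x) := by
        gcongr
        exact hp z
    _ ≤ _ := by
        rw [mul_assoc C, mul_assoc C, ← Real.exp_add, ← Real.exp_add]
        refine mul_le_mul_of_nonneg_left (Real.exp_le_exp.2 ?_) hC
        have h1 : ‖z‖ ≤ z.re ^ 2 + 1 + A := by
          have := Complex.norm_le_abs_re_add_abs_im z
          nlinarith [sq_abs z.re, sq_nonneg (|z.re| - 1), abs_nonneg z.re]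
        have h2 : -(z.im * x) ≤ A * X := by
          refine (neg_le_abs _).trans ?_
          rw [abs_mul]
          gcongr
        have h3 : z.re ^ 2 * z.im ^ 2 ≤ z.re ^ 2 * A ^ 2 := by
          gcongr 1
          exact sq_le_sq' (by linarith [(abs_le.1 hz).1]) (abs_le.1 hz).2
        nlinarith [sq_nonneg (z.re ^ 2 - (3 * A ^ 2 + 2)), sq_nonneg (z.im ^ 2)]

theorem integrable_quarticKernel (p : Polynomial ℂ) (a x : ℝ) :
    Integrable fun ω : ℝ => quarticKernel p x (ω + a * Complex.I) := by
  obtain ⟨C, hC⟩ := exists_norm_quarticKernel_le p (abs_nonneg a) |x|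
  refine ((integrable_exp_neg_mul_sq one_pos).const_mul C).mono'
    ((continuous_quarticKernel p x).comp (by fun_prop)).aestronglyMeasurable
    (.of_forall fun ω => ?_)
  simpa using hC x (ω + a * Complex.I) le_rfl (by simp)

theorem hasDerivAt_quarticKernel (p : Polynomial ℂ) (x : ℝ) (z : ℂ) :
    HasDerivAt (quarticKernel p x)
      (quarticKernel (p.derivative +
        p * (-Polynomial.C 2 * Polynomial.X ^ 3 + Polynomial.C (Complex.I * x))) x z) z := by
  have h1 : HasDerivAt (fun z : ℂ => -z ^ 4 / 2 + Complex.I * z * x)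
      (-2 * z ^ 3 + Complex.I * x) z := by
    refine (((hasDerivAt_pow 4 z).neg.div_const 2).add
      (((hasDerivAt_id z).const_mul Complex.I).mul_const (x : ℂ))).congr_deriv ?_
    push_cast
    ring
  refine ((p.hasDerivAt z).mul h1.cexp).congr_deriv ?_
  simp [quarticKernel]
  ring

theorem hasDerivAt_quarticKernel_param (p : Polynomial ℂ) (x : ℝ) (z : ℂ) :
    HasDerivAt (fun x : ℝ => quarticKernel p x z)
      (quarticKernel (Polynomial.C Complex.I * Polynomial.X * p) x z) x := by
  have h1 : HasDerivAt (fun x : ℝ => -z ^ 4 / 2 + Complex.I * z * (x : ℂ))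
      (Complex.I * z) x := by
    simpa using ((Complex.ofRealCLM.hasDerivAt (x := x)).const_mul (Complex.I * z)).const_add
      (-z ^ 4 / 2)
  refine (h1.cexp.const_mul (p.eval z)).congr_deriv ?_
  simp [quarticKernel]
  ring

theorem hasDerivAt_quarticIntegral (p : Polynomial ℂ) (a x : ℝ) :
    HasDerivAt (quarticIntegral p a)
      (quarticIntegral (Polynomial.C Complex.I * Polynomial.X * p) a x) x := by
  obtain ⟨C, hC⟩ := exists_norm_quarticKernel_le (Polynomial.C Complex.I * Polynomial.X * p)
    (abs_nonneg a) (|x| + 1)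
  refine (hasDerivAt_integral_of_dominated_loc_of_deriv_le
    (bound := fun ω => C * Real.exp (-1 * ω ^ 2)) (Metric.ball_mem_nhds x one_pos)
    (.of_forall fun y => (integrable_quarticKernel p a y).aestronglyMeasurable)
    (integrable_quarticKernel p a x) (integrable_quarticKernel _ a x).aestronglyMeasurable
    (.of_forall fun ω y hy => ?_) ((integrable_exp_neg_mul_sq one_pos).const_mul C)
    (.of_forall fun ω y _ => hasDerivAt_quarticKernel_param p y _)).2
  have hy' : |y| ≤ |x| + 1 := by
    have := abs_sub_abs_le_abs_sub y x
    rw [Metric.mem_ball, Real.dist_eq] at hy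
    linarith
  simpa using hC y (ω + a * Complex.I) hy' (by simp)

theorem hasDerivAt_quarticIntegral_shift (p : Polynomial ℂ) (a x : ℝ) :
    HasDerivAt (fun a => quarticIntegral p a x) 0 a := by
  set q := p.derivative +
    p * (-Polynomial.C 2 * Polynomial.X ^ 3 + Polynomial.C (Complex.I * x)) with hq
  have hzero : ∫ ω : ℝ, quarticKernel q x (ω + a * Complex.I) = 0 := by
    refine integral_eq_zero_of_hasDerivAt_of_integrable
      (f := fun ω : ℝ => quarticKernel p x (ω + a * Complex.I)) (fun ω => ?_)
      (integrable_quarticKernel q a x) (integrable_quarticKernel p a x)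
    have h := (hasDerivAt_quarticKernel p x (ω + a * Complex.I)).comp ω
      ((hasDerivAt_id ω).ofReal_comp.add_const (a * Complex.I))
    rwa [Complex.ofReal_one, mul_one] at h
  obtain ⟨C, hC⟩ := exists_norm_quarticKernel_le q
    (add_nonneg (abs_nonneg a) zero_le_one) |x|
  have h := (hasDerivAt_integral_of_dominated_loc_of_deriv_le
    (F := fun (b ω : ℝ) => quarticKernel p x (ω + b * Complex.I))
    (F' := fun (b ω : ℝ) => quarticKernel q x (ω + b * Complex.I) * Complex.I)
    (bound := fun ω => C * Real.exp (-1 * ω ^ 2)) (Metric.ball_mem_nhds a one_pos)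
    (.of_forall fun b => (integrable_quarticKernel p b x).aestronglyMeasurable)
    (integrable_quarticKernel p a x)
    ((integrable_quarticKernel q a x).mul_const _).aestronglyMeasurable
    (.of_forall fun ω b hb => ?_) ((integrable_exp_neg_mul_sq one_pos).const_mul C)
    (.of_forall fun ω b _ => ?_)).2
  · rwa [integral_mul_const, hzero, zero_mul] at h
  · have hb' : |b| ≤ |a| + 1 := by
      have := abs_sub_abs_le_abs_sub b a
      rw [Metric.mem_ball, Real.dist_eq] at hb
      linarith
    simpa using hC x (ω + b * Complex.I) le_rfl (by simpa using hb')
  · have h := (hasDerivAt_quarticKernel p x (ω + b * Complex.I)).comp b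
      (((hasDerivAt_id b).ofReal_comp.mul_const Complex.I).const_add (ω : ℂ))
    rwa [Complex.ofReal_one, one_mul] at h

theorem quarticIntegral_eq_zero_shift (p : Polynomial ℂ) (a x : ℝ) :
    quarticIntegral p a x = quarticIntegral p 0 x :=
  is_const_of_deriv_eq_zero
    (fun b => (hasDerivAt_quarticIntegral_shift p b x).differentiableAt)
    (fun b => (hasDerivAt_quarticIntegral_shift p b x).deriv) a 0

theorem norm_quarticIntegral_le (p : Polynomial ℂ) (a x : ℝ) :
    ‖quarticIntegral p a x‖ ≤
      (∫ ω : ℝ, ‖quarticKernel p 0 (ω + a * Complex.I)‖) * Real.exp (-(a * x)) := by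
  refine (norm_integral_le_integral_norm _).trans_eq ?_
  rw [← integral_mul_const]
  congr 1 with ω
  rw [norm_quarticKernel, norm_quarticKernel, mul_assoc ‖_‖, ← Real.exp_add]
  simp [← sub_eq_add_neg]

/-- Moving the line of integration to `im z = ±b` gives exponential decay of any rate. -/
theorem exists_norm_quarticIntegral_le_exp (p : Polynomial ℂ) (b : ℝ) :
    ∃ C : ℝ, 0 ≤ C ∧ ∀ x : ℝ, ‖quarticIntegral p 0 x‖ ≤ C * Real.exp (-(b * |x|)) := by
  set D : ℝ → ℝ := fun a => ∫ ω : ℝ, ‖quarticKernel p 0 (ω + a * Complex.I)‖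
  have hD : ∀ a, 0 ≤ D a := fun a => integral_nonneg fun ω => norm_nonneg _
  refine ⟨D b + D (-b), add_nonneg (hD _) (hD _), fun x => ?_⟩
  rcases le_total 0 x with hx | hx
  · rw [← quarticIntegral_eq_zero_shift p b, abs_of_nonneg hx]
    refine (norm_quarticIntegral_le p b x).trans ?_
    gcongr
    exact le_add_of_nonneg_right (hD _)
  · rw [← quarticIntegral_eq_zero_shift p (-b), abs_of_nonpos hx, mul_neg, ← neg_mul]
    refine (norm_quarticIntegral_le p (-b) x).trans ?_
    gcongr
    exact le_add_of_nonneg_left (hD _)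

theorem phi_eq_re_quarticIntegral (x : ℝ) :
    phi x = 1 / (2 * Real.pi) * (quarticIntegral 1 0 x).re := by
  rw [phi, quarticIntegral]
  congr 1
  refine Eq.trans ?_ (integral_re (𝕜 := ℂ) (integrable_quarticKernel 1 0 x))
  congr 1 with ω
  simp [quarticKernel, Complex.exp_re, pow_succ]

theorem hasDerivAt_re_quarticIntegral (p : Polynomial ℂ) (c x : ℝ) :
    HasDerivAt (fun x => c * (quarticIntegral p 0 x).re)
      (c * (quarticIntegral (Polynomial.C Complex.I * Polynomial.X * p) 0 x).re) x :=
  (Complex.reCLM.hasFDerivAt.comp_hasDerivAt x (hasDerivAt_quarticIntegral p 0 x)).const_mul c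

theorem iteratedDeriv_phi (k : ℕ) :
    iteratedDeriv k phi = fun x => 1 / (2 * Real.pi) *
      (quarticIntegral ((Polynomial.C Complex.I * Polynomial.X) ^ k) 0 x).re := by
  induction k with
  | zero =>
    ext x
    simp [phi_eq_re_quarticIntegral]
  | succ k ih =>
    ext x
    rw [iteratedDeriv_succ, ih, pow_succ']
    exact (hasDerivAt_re_quarticIntegral _ _ x).deriv

theorem hasDerivAt_iteratedDeriv_phi (k : ℕ) (x : ℝ) :
    HasDerivAt (iteratedDeriv k phi) (iteratedDeriv (k + 1) phi x) x := by
  rw [iteratedDeriv_phi, iteratedDeriv_phi, pow_succ']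
  exact hasDerivAt_re_quarticIntegral _ _ x

theorem exists_abs_iteratedDeriv_phi_le_exp (k : ℕ) (b : ℝ) :
    ∃ C : ℝ, 0 ≤ C ∧ ∀ x : ℝ, |iteratedDeriv k phi x| ≤ C * Real.exp (-(b * |x|)) := by
  obtain ⟨C, hC, h⟩ := exists_norm_quarticIntegral_le_exp
    ((Polynomial.C Complex.I * Polynomial.X) ^ k) b
  refine ⟨1 / (2 * Real.pi) * C, by positivity, fun x => ?_⟩
  rw [iteratedDeriv_phi, abs_mul, abs_of_pos (by positivity), mul_assoc]
  gcongr
  exact (Complex.abs_re_le_norm _).trans (h x)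

/-- For every `k` there is `C > 0` such that for all `x ∈ ℝ` and `H > 0`,
`|φ^{(k)}(x+H) − φ^{(k)}(x)| ≤ C H ( e^{−|x|} 𝟙_{|x| > 2H} + (1/(1+H)) 𝟙_{|x| ≤ 2H} )`. -/
theorem phi_deriv_increment_bound (k : ℕ) :
    ∃ C > (0 : ℝ), ∀ x H : ℝ, 0 < H →
      |iteratedDeriv k phi (x + H) - iteratedDeriv k phi x| ≤
        C * H * ((if 2 * H < |x| then Real.exp (-|x|) else 0)
          + (if |x| ≤ 2 * H then 1 / (1 + H) else 0)) := by
  obtain ⟨C₀, hC₀, h₀⟩ := exists_abs_iteratedDeriv_phi_le_exp k 0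
  obtain ⟨C₁, hC₁, h₁⟩ := exists_abs_iteratedDeriv_phi_le_exp (k + 1) 2
  simp only [zero_mul, neg_zero, Real.exp_zero, mul_one] at h₀
  have mean_value : ∀ {x H D : ℝ}, 0 < H →
      (∀ y ∈ Set.Icc x (x + H), |iteratedDeriv (k + 1) phi y| ≤ D) →
      |iteratedDeriv k phi (x + H) - iteratedDeriv k phi x| ≤ D * H := by
    intro x H D hH hD
    have h := (convex_Icc x (x + H)).norm_image_sub_le_of_norm_hasDerivWithin_le
      (fun y _ => (hasDerivAt_iteratedDeriv_phi k y).hasDerivWithinAt) hD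
      (Set.left_mem_Icc.2 (by linarith)) (Set.right_mem_Icc.2 (by linarith))
    simpa [Real.norm_eq_abs, abs_of_pos hH] using h
  refine ⟨C₁ + 2 * C₀ + 1, by positivity, fun x H hH => ?_⟩
  rcases lt_or_ge (2 * H) |x| with hx | hx
  · rw [if_pos hx, if_neg hx.not_ge, add_zero, mul_right_comm]
    refine mean_value hH fun y hy => (h₁ y).trans ?_
    have hxy : |x| - |y| ≤ H := by
      refine (abs_sub_abs_le_abs_sub x y).trans ?_
      rw [abs_le]
      constructor <;> linarith [hy.1, hy.2]
    gcongr <;> linarith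
  · rw [if_neg hx.not_gt, if_pos hx, zero_add, mul_one_div, le_div_iff₀ (by positivity)]
    have hlip : |iteratedDeriv k phi (x + H) - iteratedDeriv k phi x| ≤ C₁ * H :=
      mean_value hH fun y _ => (h₁ y).trans
        (mul_le_of_le_one_right hC₁ (Real.exp_le_one_iff.2 (by linarith [abs_nonneg y])))
    have hbdd : |iteratedDeriv k phi (x + H) - iteratedDeriv k phi x| ≤ 2 * C₀ := by
      linarith [abs_sub (iteratedDeriv k phi (x + H)) (iteratedDeriv k phi x),
        h₀ (x + H), h₀ x]
    nlinarith [mul_le_mul_of_nonneg_right hbdd hH.le]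
end

section
/- There exists a constant C > 0 such that for every measurable function a : ℝ → ℝ with |a(y)| ≤ 1 for all y, every x ∈ ℝ, every t > 0 and every h > 0, ∫₀^t ds ∫_ℝ dy (1/(t−s)) [ φ'((x+h−y)/(t−s)^{1/4}) − φ'((x−y)/(t−s)^{1/4}) ]² a(y)² ≤ C h log(1 + h^{−1} t^{1/4}). (This integral is the second moment E(Y(x+h,t) − Y(x,t))² of the spatial increment of the stochastic convolution Y associated with G and white noise.) -/
open MeasureTheory Real

open Filter

/-- The cosine transform of `f` with phase `c`. -/
noncomputable def cosTransform (f : ℝ → ℝ) (c x : ℝ) : ℝ :=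
  ∫ ω : ℝ, f ω * Real.cos (ω * x + c)

lemma integrable_mul_cos {f : ℝ → ℝ} (hf : Integrable f) (x c : ℝ) :
    Integrable fun ω => f ω * Real.cos (ω * x + c) :=
  hf.mul_bdd (c := 1) (by fun_prop)
    (Eventually.of_forall fun ω => by simpa using Real.abs_cos_le_one (ω * x + c))

lemma integrable_mul_sin {f : ℝ → ℝ} (hf : Integrable f) (x c : ℝ) :
    Integrable fun ω => f ω * Real.sin (ω * x + c) :=
  hf.mul_bdd (c := 1) (by fun_prop)
    (Eventually.of_forall fun ω => by simpa using Real.abs_sin_le_one (ω * x + c))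

lemma abs_cosTransform_le {f : ℝ → ℝ} (hf : Integrable f) (c x : ℝ) :
    |cosTransform f c x| ≤ ∫ ω, |f ω| := by
  refine norm_integral_le_of_norm_le (f := fun ω => f ω * Real.cos (ω * x + c)) hf.abs
    (Eventually.of_forall fun ω => ?_)
  rw [Real.norm_eq_abs, abs_mul]
  exact mul_le_of_le_one_right (abs_nonneg _) (Real.abs_cos_le_one _)

lemma abs_mul_abs_cosTransform_le {f f' : ℝ → ℝ} (hf : Integrable f) (hf' : Integrable f')
    (hd : ∀ ω, HasDerivAt f (f' ω) ω) (c x : ℝ) :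
    |x| * |cosTransform f c x| ≤ ∫ ω, |f' ω| := by
  have hs : ∀ ω, HasDerivAt (fun ω => Real.sin (ω * x + c)) (Real.cos (ω * x + c) * x) ω := by
    intro ω
    simpa using (((hasDerivAt_id ω).mul_const x).add_const c).sin
  have hparts := integral_mul_deriv_eq_deriv_mul_of_integrable (u := f) (u' := f')
    (v := fun ω => Real.sin (ω * x + c)) (v' := fun ω => Real.cos (ω * x + c) * x) (fun ω _ => hd ω) (fun ω _ => hs ω)
    (by
      have := (integrable_mul_cos hf x c).mul_const x
      simpa [Pi.mul_def, mul_assoc] using this)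
    (integrable_mul_sin hf' x c) (integrable_mul_sin hf x c)
  have hx : cosTransform f c x * x = -∫ ω, f' ω * Real.sin (ω * x + c) := by
    rw [← hparts, cosTransform, ← integral_mul_const]
    simp only [mul_assoc]
  rw [mul_comm, ← abs_mul, hx, abs_neg]
  refine norm_integral_le_of_norm_le (f := fun ω => f' ω * Real.sin (ω * x + c)) hf'.abs
    (Eventually.of_forall fun ω => ?_)
  rw [Real.norm_eq_abs, abs_mul]
  exact mul_le_of_le_one_right (abs_nonneg _) (Real.abs_sin_le_one _)

lemma exists_abs_cosTransform_le_div {f f' : ℝ → ℝ} (hf : Integrable f) (hf' : Integrable f')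
    (hd : ∀ ω, HasDerivAt f (f' ω) ω) (c : ℝ) :
    ∃ M, ∀ x, |cosTransform f c x| ≤ M / (1 + |x|) := by
  refine ⟨(∫ ω, |f ω|) + ∫ ω, |f' ω|, fun x => ?_⟩
  rw [le_div_iff₀ (by positivity)]
  linarith [abs_cosTransform_le hf c x, abs_mul_abs_cosTransform_le hf hf' hd c x]

lemma hasDerivAt_cosTransform {f : ℝ → ℝ} (hf : Integrable f)
    (hf' : Integrable fun ω => ω * f ω) (c x : ℝ) :
    HasDerivAt (cosTransform f c) (cosTransform (fun ω => ω * f ω) (c + π / 2) x) x := by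
  refine (hasDerivAt_integral_of_dominated_loc_of_deriv_le (μ := volume)
    (F := fun x ω => f ω * Real.cos (ω * x + c))
    (F' := fun x ω => ω * f ω * Real.cos (ω * x + (c + π / 2)))
    (bound := fun ω => |ω * f ω|) univ_mem ?_ (integrable_mul_cos hf x c) ?_ ?_ hf'.abs ?_).2
  · exact Eventually.of_forall fun x => (integrable_mul_cos hf x c).aestronglyMeasurable
  · exact (integrable_mul_cos hf' x _).aestronglyMeasurable
  · refine Eventually.of_forall fun ω x _ => ?_
    rw [Real.norm_eq_abs, abs_mul]
    exact mul_le_of_le_one_right (abs_nonneg _) (Real.abs_cos_le_one _)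
  · refine Eventually.of_forall fun ω x _ => ?_
    have h := ((((hasDerivAt_id x).const_mul ω).add_const c).cos).const_mul (f ω)
    refine h.congr_deriv ?_
    rw [← add_assoc, Real.cos_add_pi_div_two]
    simp
    ring

lemma integrable_pow_mul_exp_neg_pow_four (k : ℕ) :
    Integrable fun ω : ℝ => ω ^ k * Real.exp (-(ω ^ 4) / 2) := by
  have h : Integrable fun ω : ℝ => ω ^ k * Real.exp (-1 * ω ^ 2) := by
    have := integrable_rpow_mul_exp_neg_mul_sq one_pos (s := k)
      (by have : (0 : ℝ) ≤ k := k.cast_nonneg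
          linarith)
    simpa only [Real.rpow_natCast] using this
  refine (h.mul_const (Real.exp (1 / 2))).mono (by fun_prop) (Eventually.of_forall fun ω => ?_)
  rw [mul_assoc, ← Real.exp_add, norm_mul, norm_mul]
  gcongr
  simp only [Real.norm_eq_abs, Real.abs_exp]
  gcongr
  nlinarith [sq_nonneg (ω ^ 2 - 1)]

lemma hasDerivAt_exp_neg_pow_four (ω : ℝ) :
    HasDerivAt (fun ω : ℝ => Real.exp (-(ω ^ 4) / 2))
      (-2 * ω ^ 3 * Real.exp (-(ω ^ 4) / 2)) ω := by
  refine (((hasDerivAt_pow 4 ω).neg.div_const 2).exp).congr_deriv ?_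
  norm_num
  ring

lemma phi_eq_cosTransform (x : ℝ) :
    phi x = (1 / (2 * π)) * cosTransform (fun ω => ω ^ 0 * Real.exp (-(ω ^ 4) / 2)) 0 x := by
  simp [phi, cosTransform]

lemma exists_deriv_phi_bounds : ∃ (ψ' : ℝ → ℝ) (M : ℝ), 0 < M ∧
    (∀ x, HasDerivAt (deriv phi) (ψ' x) x) ∧
    (∀ x, |deriv phi x| ≤ M / (1 + |x|)) ∧ ∀ x, |ψ' x| ≤ M / (1 + |x|) := by
  have hmul (k : ℕ) : (fun ω : ℝ => ω * (ω ^ k * Real.exp (-(ω ^ 4) / 2))) =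
      fun ω => ω ^ (k + 1) * Real.exp (-(ω ^ 4) / 2) := by
    ext ω
    ring
  have hT (k : ℕ) (c x : ℝ) :
      HasDerivAt (cosTransform (fun ω => ω ^ k * Real.exp (-(ω ^ 4) / 2)) c)
        (cosTransform (fun ω => ω ^ (k + 1) * Real.exp (-(ω ^ 4) / 2)) (c + π / 2) x) x := by
    have := hasDerivAt_cosTransform (integrable_pow_mul_exp_neg_pow_four k)
      (by rw [hmul]; exact integrable_pow_mul_exp_neg_pow_four _) c x
    rwa [hmul] at this
  have hbound (k : ℕ) (c : ℝ) : ∃ M, ∀ x,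
      |cosTransform (fun ω => ω ^ (k + 1) * Real.exp (-(ω ^ 4) / 2)) c x| ≤ M / (1 + |x|) := by
    refine exists_abs_cosTransform_le_div (integrable_pow_mul_exp_neg_pow_four _)
      (f' := fun ω => (k + 1) * (ω ^ k * Real.exp (-(ω ^ 4) / 2))
        + -2 * (ω ^ (k + 4) * Real.exp (-(ω ^ 4) / 2)))
      (((integrable_pow_mul_exp_neg_pow_four k).const_mul _).add
        ((integrable_pow_mul_exp_neg_pow_four (k + 4)).const_mul _)) (fun ω => ?_) c
    refine ((hasDerivAt_pow (k + 1) ω).mul (hasDerivAt_exp_neg_pow_four ω)).congr_deriv ?_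
    push_cast
    ring
  have hphi : deriv phi = fun x => (1 / (2 * π)) *
      cosTransform (fun ω => ω ^ (0 + 1) * Real.exp (-(ω ^ 4) / 2)) (0 + π / 2) x := by
    ext x
    rw [funext phi_eq_cosTransform]
    exact ((hT 0 0 x).const_mul _).deriv
  obtain ⟨M₁, h₁⟩ := hbound 0 (0 + π / 2)
  obtain ⟨M₂, h₂⟩ := hbound 1 (0 + π / 2 + π / 2)
  have hpos : 0 < 1 / (2 * π) := by positivity
  have hM₁ : 1 / (2 * π) * M₁ ≤ 1 / (2 * π) * (|M₁| + |M₂| + 1) := by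
    gcongr
    linarith [le_abs_self M₁, abs_nonneg M₂]
  have hM₂ : 1 / (2 * π) * M₂ ≤ 1 / (2 * π) * (|M₁| + |M₂| + 1) := by
    gcongr
    linarith [le_abs_self M₂, abs_nonneg M₁]
  refine ⟨fun x => (1 / (2 * π)) *
      cosTransform (fun ω => ω ^ (1 + 1) * Real.exp (-(ω ^ 4) / 2)) (0 + π / 2 + π / 2) x,
    1 / (2 * π) * (|M₁| + |M₂| + 1), by positivity, fun x => ?_, fun x => ?_, fun x => ?_⟩
  · rw [hphi]
    exact (hT 1 _ x).const_mul _
  · rw [hphi]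
    simp only [abs_mul, abs_of_pos hpos]
    calc _ ≤ 1 / (2 * π) * (M₁ / (1 + |x|)) := by gcongr; exact h₁ x
      _ = 1 / (2 * π) * M₁ / (1 + |x|) := by ring
      _ ≤ _ := by gcongr
  · simp only [abs_mul, abs_of_pos hpos]
    calc _ ≤ 1 / (2 * π) * (M₂ / (1 + |x|)) := by gcongr; exact h₂ x
      _ = 1 / (2 * π) * M₂ / (1 + |x|) := by ring
      _ ≤ _ := by gcongr

lemma sq_le_of_abs_le_div {p M x : ℝ} (h : |p| ≤ M / (1 + |x|)) :
    p ^ 2 ≤ M ^ 2 * (1 + x ^ 2)⁻¹ := by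
  rw [← sq_abs p]
  calc |p| ^ 2 ≤ (M / (1 + |x|)) ^ 2 := by gcongr
    _ = M ^ 2 * ((1 + |x|) ^ 2)⁻¹ := by rw [div_pow, div_eq_mul_inv]
    _ ≤ _ := by
      gcongr
      nlinarith [sq_abs x, abs_nonneg x]

lemma sq_increment_le {ψ ψ' : ℝ → ℝ} {M : ℝ} (hM : 0 < M)
    (hd : ∀ x, HasDerivAt ψ (ψ' x) x) (h₀ : ∀ x, |ψ x| ≤ M / (1 + |x|))
    (h₁ : ∀ x, |ψ' x| ≤ M / (1 + |x|)) (z : ℝ) {δ : ℝ} (hδ : 0 < δ) :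
    (ψ (z + δ) - ψ z) ^ 2 ≤
      16 * M ^ 2 * (δ / (1 + δ)) ^ 2 * ((1 + (z + δ) ^ 2)⁻¹ + (1 + z ^ 2)⁻¹) := by
  have hw₁ : 0 < (1 + (z + δ) ^ 2)⁻¹ := by positivity
  have hw₂ : 0 < (1 + z ^ 2)⁻¹ := by positivity
  rcases le_total δ 1 with hδ1 | hδ1
  · have hinc : |ψ (z + δ) - ψ z| ≤ (2 * M * δ) / (1 + |z|) := by
      have hmv := (convex_Icc z (z + δ)).norm_image_sub_le_of_norm_hasDerivWithin_le
        (f := ψ) (f' := ψ') (C := 2 * M / (1 + |z|)) (x := z) (y := z + δ)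
        (fun y _ => (hd y).hasDerivWithinAt) (fun y hy => ?_)
        ⟨le_rfl, by linarith⟩ ⟨by linarith, le_rfl⟩
      · rw [Real.norm_eq_abs, Real.norm_eq_abs, add_sub_cancel_left, abs_of_pos hδ] at hmv
        exact hmv.trans_eq (by ring)
      · refine (h₁ y).trans ?_
        rw [div_le_div_iff₀ (by positivity) (by positivity)]
        have : |z| ≤ |y| + 1 := by
          have h := abs_sub_abs_le_abs_sub z y
          have h' : |z - y| ≤ 1 := abs_le.2 ⟨by linarith [hy.2], by linarith [hy.1]⟩
          linarith
        nlinarith [abs_nonneg y]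
    have hδ' : δ ≤ 2 * (δ / (1 + δ)) := by
      rw [mul_div_assoc', le_div_iff₀ (by positivity)]
      nlinarith
    calc _ ≤ (2 * M * δ) ^ 2 * (1 + z ^ 2)⁻¹ := sq_le_of_abs_le_div hinc
      _ ≤ (2 * M * (2 * (δ / (1 + δ)))) ^ 2 * (1 + z ^ 2)⁻¹ := by gcongr
      _ = 16 * M ^ 2 * (δ / (1 + δ)) ^ 2 * (0 + (1 + z ^ 2)⁻¹) := by ring
      _ ≤ _ := by gcongr
  · have hδ' : 1 ≤ 2 * (δ / (1 + δ)) := by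
      rw [mul_div_assoc', le_div_iff₀ (by positivity)]
      linarith
    have e₁ := sq_le_of_abs_le_div (h₀ (z + δ))
    have e₂ := sq_le_of_abs_le_div (h₀ z)
    calc _ ≤ 2 * (M ^ 2 * (1 + (z + δ) ^ 2)⁻¹) + 2 * (M ^ 2 * (1 + z ^ 2)⁻¹) := by
          nlinarith [sq_nonneg (ψ (z + δ) + ψ z)]
      _ = 2 * M ^ 2 * 1 ^ 2 * ((1 + (z + δ) ^ 2)⁻¹ + (1 + z ^ 2)⁻¹) := by ring
      _ ≤ 4 * M ^ 2 * (2 * (δ / (1 + δ))) ^ 2 * ((1 + (z + δ) ^ 2)⁻¹ + (1 + z ^ 2)⁻¹) := by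
          gcongr
          norm_num
      _ = _ := by ring

lemma integrable_inv_one_add_sub_div_sq (b : ℝ) {r : ℝ} (hr : 0 < r) :
    Integrable fun y : ℝ => (1 + ((b - y) / r) ^ 2)⁻¹ :=
  (integrable_inv_one_add_sq.comp_div hr.ne').comp_sub_left b

lemma integral_inv_one_add_sub_div_sq (b : ℝ) {r : ℝ} (hr : 0 < r) :
    ∫ y : ℝ, (1 + ((b - y) / r) ^ 2)⁻¹ = r * π := by
  rw [integral_sub_left_eq_self (fun y : ℝ => (1 + (y / r) ^ 2)⁻¹) volume b,
    Measure.integral_comp_div (fun y : ℝ => (1 + y ^ 2)⁻¹) r, integral_univ_inv_one_add_sq,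
    abs_of_pos hr, smul_eq_mul]

lemma integral_sq_scaled_increment_le {ψ ψ' : ℝ → ℝ} {M : ℝ} (hM : 0 < M)
    (hd : ∀ x, HasDerivAt ψ (ψ' x) x) (h₀ : ∀ x, |ψ x| ≤ M / (1 + |x|))
    (h₁ : ∀ x, |ψ' x| ≤ M / (1 + |x|)) {a : ℝ → ℝ} (ha : ∀ y, |a y| ≤ 1) (x : ℝ)
    {h r u : ℝ} (hh : 0 < h) (hr : 0 < r) (hu : 0 < u) :
    ∫ y : ℝ, (1 / u) * (ψ ((x + h - y) / r) - ψ ((x - y) / r)) ^ 2 * a y ^ 2 ≤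
      32 * π * M ^ 2 * (h / (h + r)) ^ 2 * (r / u) := by
  have hδ : h / r / (1 + h / r) = h / (h + r) := by
    field_simp
    ring
  calc _ ≤ ∫ y : ℝ, (1 / u) * (16 * M ^ 2 * (h / (h + r)) ^ 2) *
        ((1 + ((x + h - y) / r) ^ 2)⁻¹ + (1 + ((x - y) / r) ^ 2)⁻¹) := by
        refine integral_mono_of_nonneg (Eventually.of_forall fun y => by positivity)
          (((integrable_inv_one_add_sub_div_sq _ hr).add
            (integrable_inv_one_add_sub_div_sq _ hr)).const_mul _)
          (Eventually.of_forall fun y => ?_)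
        have hz : (x + h - y) / r = (x - y) / r + h / r := by ring
        have hinc := sq_increment_le hM hd h₀ h₁ ((x - y) / r) (div_pos hh hr)
        rw [hδ, ← hz] at hinc
        have hay : a y ^ 2 ≤ 1 := (sq_le_one_iff_abs_le_one _).2 (ha y)
        refine (mul_le_of_le_one_right (by positivity) hay).trans ?_
        simp only [mul_assoc (1 / u)]
        gcongr
    _ = _ := by
        rw [integral_const_mul, integral_add (integrable_inv_one_add_sub_div_sq _ hr)
          (integrable_inv_one_add_sub_div_sq _ hr), integral_inv_one_add_sub_div_sq _ hr,
          integral_inv_one_add_sub_div_sq _ hr]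
        ring

lemma intervalIntegral_le_sub_of_le_deriv {f g g' : ℝ → ℝ} {a b : ℝ} (hab : a ≤ b)
    (hc : ContinuousOn g (Set.Icc a b)) (hd : ∀ s ∈ Set.Ioo a b, HasDerivAt g (g' s) s)
    (hg' : ∀ s ∈ Set.Ioo a b, 0 ≤ g' s) (hfg : ∀ s ∈ Set.Ioo a b, f s ≤ g' s) :
    ∫ s in a..b, f s ≤ g b - g a := by
  have hint : IntervalIntegrable g' volume a b :=
    (intervalIntegrable_iff_integrableOn_Ioc_of_le hab).2
      (intervalIntegral.integrableOn_deriv_of_nonneg hc hd hg')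
  have hFTC := intervalIntegral.integral_eq_sub_of_hasDerivAt_of_le hab hc hd hint
  rw [← hFTC]
  by_cases hf : IntervalIntegrable f volume a b
  · exact intervalIntegral.integral_mono_on_of_le_Ioo hab hf hint hfg
  · rw [intervalIntegral.integral_undef hf, intervalIntegral.integral_of_le hab,
      integral_Ioc_eq_integral_Ioo]
    exact setIntegral_nonneg measurableSet_Ioo hg'

/-- There is `C > 0` such that for every measurable `a : ℝ → ℝ` with `|a| ≤ 1`, every
`x ∈ ℝ`, `t > 0` and `h > 0`,
`∫₀^t ds ∫_ℝ dy (1/(t−s)) [φ'((x+h−y)/(t−s)^{1/4}) − φ'((x−y)/(t−s)^{1/4})]² a(y)²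
  ≤ C h log(1 + h⁻¹ t^{1/4})`
(the second moment `E(Y(x+h,t) − Y(x,t))²` of the spatial increment of `Y`). -/
theorem spatial_increment_bound_Y :
    ∃ C > (0 : ℝ), ∀ a : ℝ → ℝ, Measurable a → (∀ y, |a y| ≤ 1) →
      ∀ x t h : ℝ, 0 < t → 0 < h →
        (∫ s in (0 : ℝ)..t, ∫ y : ℝ,
            (1 / (t - s)) *
              (deriv phi ((x + h - y) / (t - s) ^ ((1 : ℝ) / 4))
                - deriv phi ((x - y) / (t - s) ^ ((1 : ℝ) / 4))) ^ 2 * a y ^ 2)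
          ≤ C * h * Real.log (1 + h⁻¹ * t ^ ((1 : ℝ) / 4)) := by
  obtain ⟨ψ', M, hM, hd, h₀, h₁⟩ := exists_deriv_phi_bounds
  refine ⟨128 * π * M ^ 2, by positivity, fun a _ ha x t h ht hh => ?_⟩
  have hrpow (s : ℝ) (hs : s ≤ t) : 0 ≤ (t - s) ^ ((1 : ℝ) / 4) :=
    Real.rpow_nonneg (by linarith) _
  refine (intervalIntegral_le_sub_of_le_deriv
    (g := fun s => 128 * π * M ^ 2 * (h ^ 2 / (h + (t - s) ^ ((1 : ℝ) / 4))))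
    (g' := fun s => 32 * π * M ^ 2 * (h / (h + (t - s) ^ ((1 : ℝ) / 4))) ^ 2 *
      ((t - s) ^ ((1 : ℝ) / 4) / (t - s))) ht.le ?_ ?_ ?_ ?_).trans ?_
  · refine continuousOn_const.mul (continuousOn_const.div ?_ fun s hs => ?_)
    · exact (continuous_const.add ((continuous_const.sub continuous_id).rpow_const
        fun _ => Or.inr (by norm_num))).continuousOn
    · have := hrpow s hs.2
      positivity
  · intro s hs
    have hu : 0 < t - s := by linarith [hs.2]
    have hr := hrpow s hs.2.le
    have hne : h + (t - s) ^ ((1 : ℝ) / 4) ≠ 0 := by positivity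
    have hder := ((((hasDerivAt_id s).const_sub t).rpow_const (p := (1 : ℝ) / 4)
      (Or.inl hu.ne')).const_add h)
    refine (((hasDerivAt_const s (h ^ 2)).div hder hne).const_mul
      (128 * π * M ^ 2)).congr_deriv ?_
    simp only [id, Real.rpow_sub_one hu.ne']
    field_simp
    ring
  · intro s hs
    have hu : 0 < t - s := by linarith [hs.2]
    positivity
  · intro s hs
    have hu : 0 < t - s := by linarith [hs.2]
    exact integral_sq_scaled_increment_le hM hd h₀ h₁ ha x hh (by positivity) hu
  · have hT : 0 < t ^ ((1 : ℝ) / 4) := by positivity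
    have hlog := Real.one_sub_inv_le_log_of_pos
      (show 0 < 1 + h⁻¹ * t ^ ((1 : ℝ) / 4) by positivity)
    rw [mul_assoc (128 * π * M ^ 2)]
    simp only [sub_self, sub_zero]
    rw [Real.zero_rpow (by norm_num), add_zero, ← mul_sub]
    gcongr
    refine le_trans (le_of_eq ?_) (mul_le_mul_of_nonneg_left hlog hh.le)
    field_simp
end

section
/- Let T > 0, let u₀ : ℝ → ℝ be continuous and bounded, and let q : ℝ × [0,T] → ℝ be continuous and bounded. If u and ũ are both continuous bounded functions on ℝ × [0,T] satisfying the integral equation u(x,t) = ∫_ℝ G(x,y,t) u₀(y) dy + ∫₀^t ∫_ℝ ∂_y² G(x,y,t−s) V'(u(y,s)) dy ds + q(x,t) for all (x,t) ∈ ℝ × [0,T], then u = ũ on ℝ × [0,T]. -/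
open MeasureTheory Real

/-- `G(x,y,t) = t^{−1/4} φ((x−y) t^{−1/4})`, the Green function of `e^{−(t/2)Δ²}` on `ℝ`. -/
noncomputable def G (x y t : ℝ) : ℝ :=
  t ^ (-(1 / 4) : ℝ) * phi ((x - y) * t ^ (-(1 / 4) : ℝ))

/-- `∂_y² G(x,y,t) = t^{−3/4} φ''((x−y) t^{−1/4})`. -/
noncomputable def Gyy (x y t : ℝ) : ℝ :=
  t ^ (-(3 / 4) : ℝ) * iteratedDeriv 2 phi ((x - y) * t ^ (-(1 / 4) : ℝ))

/-- `V'(u) = u³ − u` for the double-well potential `V(u) = (1/4)(u²−1)²`. -/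
def Vp (u : ℝ) : ℝ := u ^ 3 - u

/-- `u` is a continuous bounded mild solution on `ℝ × [0,T]` of the Cahn–Hilliard
integral equation `u(x,t) = ∫ G(x,y,t) u₀(y) dy + ∫₀^t ∫ ∂_y²G(x,y,t−s) V'(u(y,s)) dy ds
+ q(x,t)`. -/
def IsMildSolution (T : ℝ) (u₀ : ℝ → ℝ) (q : ℝ → ℝ → ℝ) (u : ℝ → ℝ → ℝ) : Prop :=
  ContinuousOn (fun p : ℝ × ℝ => u p.1 p.2) (Set.univ ×ˢ Set.Icc 0 T) ∧
  (∃ K : ℝ, ∀ x : ℝ, ∀ t ∈ Set.Icc (0 : ℝ) T, |u x t| ≤ K) ∧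
  (∀ x : ℝ, ∀ t ∈ Set.Ioc (0 : ℝ) T,
    u x t = (∫ y : ℝ, G x y t * u₀ y)
      + (∫ s in (0 : ℝ)..t, ∫ y : ℝ, Gyy x y (t - s) * Vp (u y s))
      + q x t)

lemma integrable_pow_mul_exp_quartic (n : ℕ) :
    Integrable fun ω : ℝ => ω ^ n * exp (-(ω ^ 4) / 2) := by
  have h := (integrable_rpow_mul_exp_neg_mul_sq (b := 1) one_pos (s := n)
    (by have : (0 : ℝ) ≤ n := n.cast_nonneg
        linarith)).const_mul (exp (1 / 2))
  refine h.mono (by fun_prop) (.of_forall fun ω => ?_)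
  simp only [rpow_natCast, norm_mul, norm_eq_abs, abs_exp]
  rw [mul_left_comm, ← exp_add]
  gcongr
  nlinarith [sq_nonneg (ω ^ 2 - 1)]

lemma integrable_pow_mul_exp_quartic_mul (n : ℕ) {f : ℝ → ℝ} (hf : Continuous f)
    (hb : ∀ ω, |f ω| ≤ 1) :
    Integrable fun ω : ℝ => ω ^ n * exp (-(ω ^ 4) / 2) * f ω :=
  (integrable_pow_mul_exp_quartic n).mul_bdd (c := 1) hf.aestronglyMeasurable (.of_forall hb)

lemma integrable_pow_mul_exp_quartic_mul_cos (n : ℕ) (x : ℝ) :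
    Integrable fun ω : ℝ => ω ^ n * exp (-(ω ^ 4) / 2) * cos (ω * x) :=
  integrable_pow_mul_exp_quartic_mul n (by fun_prop) fun _ => abs_cos_le_one _

lemma integrable_pow_mul_exp_quartic_mul_sin (n : ℕ) (x : ℝ) :
    Integrable fun ω : ℝ => ω ^ n * exp (-(ω ^ 4) / 2) * sin (ω * x) :=
  integrable_pow_mul_exp_quartic_mul n (by fun_prop) fun _ => abs_sin_le_one _

lemma hasDerivAt_integral_cos (n : ℕ) (x : ℝ) :
    HasDerivAt (fun x => ∫ ω : ℝ, ω ^ n * exp (-(ω ^ 4) / 2) * cos (ω * x))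
      (-∫ ω : ℝ, ω ^ (n + 1) * exp (-(ω ^ 4) / 2) * sin (ω * x)) x := by
  rw [← integral_neg]
  refine (hasDerivAt_integral_of_dominated_loc_of_deriv_le (s := Set.univ) Filter.univ_mem
    (F := fun x ω => ω ^ n * exp (-(ω ^ 4) / 2) * cos (ω * x))
    (F' := fun x ω => -(ω ^ (n + 1) * exp (-(ω ^ 4) / 2) * sin (ω * x)))
    (bound := fun ω => |ω ^ (n + 1) * exp (-(ω ^ 4) / 2)|)
    (.of_forall fun _ => by fun_prop) (integrable_pow_mul_exp_quartic_mul_cos n x)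
    (by fun_prop) (.of_forall fun ω y _ => ?_)
    (integrable_pow_mul_exp_quartic (n + 1)).abs (.of_forall fun ω y _ => ?_)).2
  · rw [norm_neg, norm_mul]
    exact mul_le_of_le_one_right (norm_nonneg _) (abs_sin_le_one _)
  · refine (((hasDerivAt_id' y).const_mul ω).cos.const_mul
      (ω ^ n * exp (-(ω ^ 4) / 2))).congr_deriv ?_
    ring

lemma hasDerivAt_integral_sin (n : ℕ) (x : ℝ) :
    HasDerivAt (fun x => ∫ ω : ℝ, ω ^ n * exp (-(ω ^ 4) / 2) * sin (ω * x))
      (∫ ω : ℝ, ω ^ (n + 1) * exp (-(ω ^ 4) / 2) * cos (ω * x)) x := by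
  refine (hasDerivAt_integral_of_dominated_loc_of_deriv_le (s := Set.univ) Filter.univ_mem
    (F := fun x ω => ω ^ n * exp (-(ω ^ 4) / 2) * sin (ω * x))
    (F' := fun x ω => ω ^ (n + 1) * exp (-(ω ^ 4) / 2) * cos (ω * x))
    (bound := fun ω => |ω ^ (n + 1) * exp (-(ω ^ 4) / 2)|)
    (.of_forall fun _ => by fun_prop) (integrable_pow_mul_exp_quartic_mul_sin n x)
    (by fun_prop) (.of_forall fun ω y _ => ?_)
    (integrable_pow_mul_exp_quartic (n + 1)).abs (.of_forall fun ω y _ => ?_)).2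
  · rw [norm_mul]
    exact mul_le_of_le_one_right (norm_nonneg _) (abs_cos_le_one _)
  · refine (((hasDerivAt_id' y).const_mul ω).sin.const_mul
      (ω ^ n * exp (-(ω ^ 4) / 2))).congr_deriv ?_
    ring

lemma iteratedDeriv_two_phi (x : ℝ) :
    iteratedDeriv 2 phi x =
      -(1 / (2 * π)) * ∫ ω : ℝ, ω ^ 2 * exp (-(ω ^ 4) / 2) * cos (ω * x) := by
  have h1 : deriv phi = fun x =>
      (1 / (2 * π)) * -∫ ω : ℝ, ω ^ 1 * exp (-(ω ^ 4) / 2) * sin (ω * x) := by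
    ext x
    have h := ((hasDerivAt_integral_cos 0 x).const_mul (1 / (2 * π))).deriv
    simp only [pow_zero, one_mul] at h
    exact h
  rw [iteratedDeriv_succ, iteratedDeriv_one, h1]
  refine (((hasDerivAt_integral_sin 1 x).neg.const_mul (1 / (2 * π))).deriv).trans ?_
  ring

lemma continuous_iteratedDeriv_two_phi : Continuous (iteratedDeriv 2 phi) := by
  rw [funext iteratedDeriv_two_phi]
  exact continuous_const.mul (continuous_iff_continuousAt.2 fun x =>
    (hasDerivAt_integral_cos 2 x).continuousAt)

lemma hasDerivAt_exp_quartic (ω : ℝ) :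
    HasDerivAt (fun ω : ℝ => exp (-(ω ^ 4) / 2)) (exp (-(ω ^ 4) / 2) * (-(2 * ω ^ 3))) ω := by
  refine ((hasDerivAt_pow 4 ω).fun_neg.div_const 2).exp.congr_deriv ?_
  push_cast
  ring

lemma sq_mul_integral_sq_cos (x : ℝ) :
    x ^ 2 * ∫ ω : ℝ, ω ^ 2 * exp (-(ω ^ 4) / 2) * cos (ω * x) =
      -∫ ω : ℝ, (2 * (ω ^ 0 * exp (-(ω ^ 4) / 2)) - 14 * (ω ^ 4 * exp (-(ω ^ 4) / 2))
        + 4 * (ω ^ 8 * exp (-(ω ^ 4) / 2))) * cos (ω * x) := by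
  have c := fun n => integrable_pow_mul_exp_quartic_mul_cos n x
  have s := fun n => integrable_pow_mul_exp_quartic_mul_sin n x
  have e1 := integral_mul_deriv_eq_deriv_mul_of_integrable
    (u := fun ω : ℝ => ω ^ 2 * exp (-(ω ^ 4) / 2)) (v := fun ω => sin (ω * x))
    (u' := fun ω => 2 * (ω ^ 1 * exp (-(ω ^ 4) / 2)) - 2 * (ω ^ 5 * exp (-(ω ^ 4) / 2)))
    (v' := fun ω => cos (ω * x) * x)
    (fun ω _ => by
      refine ((hasDerivAt_pow 2 ω).mul (hasDerivAt_exp_quartic ω)).congr_deriv ?_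
      push_cast
      ring)
    (fun ω _ => by simpa using ((hasDerivAt_id ω).mul_const x).sin)
    (((c 2).mul_const x).congr (.of_forall fun ω => by simp only [Pi.mul_apply]; ring))
    ((((s 1).const_mul 2).sub ((s 5).const_mul 2)).congr
      (.of_forall fun ω => by simp only [Pi.mul_apply, Pi.sub_apply]; ring))
    (s 2)
  have e2 := integral_mul_deriv_eq_deriv_mul_of_integrable
    (u := fun ω : ℝ => 2 * (ω ^ 1 * exp (-(ω ^ 4) / 2)) - 2 * (ω ^ 5 * exp (-(ω ^ 4) / 2)))
    (v := fun ω => cos (ω * x))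
    (u' := fun ω => 2 * (ω ^ 0 * exp (-(ω ^ 4) / 2)) - 14 * (ω ^ 4 * exp (-(ω ^ 4) / 2))
        + 4 * (ω ^ 8 * exp (-(ω ^ 4) / 2)))
    (v' := fun ω => -sin (ω * x) * x)
    (fun ω _ => by
      refine ((((hasDerivAt_pow 1 ω).mul (hasDerivAt_exp_quartic ω)).const_mul 2).sub
        (((hasDerivAt_pow 5 ω).mul (hasDerivAt_exp_quartic ω)).const_mul 2)).congr_deriv ?_
      push_cast
      ring)
    (fun ω _ => by simpa using ((hasDerivAt_id ω).mul_const x).cos)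
    ((((s 5).const_mul (2 * x)).sub ((s 1).const_mul (2 * x))).congr
      (.of_forall fun ω => by simp only [Pi.mul_apply, Pi.sub_apply]; ring))
    (((((c 0).const_mul 2).sub ((c 4).const_mul 14)).add ((c 8).const_mul 4)).congr
      (.of_forall fun ω => by simp only [Pi.mul_apply, Pi.sub_apply, Pi.add_apply]; ring))
    ((((c 1).const_mul 2).sub ((c 5).const_mul 2)).congr
      (.of_forall fun ω => by simp only [Pi.mul_apply, Pi.sub_apply]; ring))
  simp only [← mul_assoc, integral_mul_const, mul_neg, neg_mul, integral_neg] at e1 e2 ⊢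
  rw [pow_two x]
  linear_combination x * e1 + e2

lemma integrable_iteratedDeriv_two_phi : Integrable (iteratedDeriv 2 phi) := by
  have i := integrable_pow_mul_exp_quartic
  have i' : Integrable fun ω : ℝ => 2 * (ω ^ 0 * exp (-(ω ^ 4) / 2))
      - 14 * (ω ^ 4 * exp (-(ω ^ 4) / 2)) + 4 * (ω ^ 8 * exp (-(ω ^ 4) / 2)) := (((i 0).const_mul 2).sub ((i 4).const_mul 14)).add ((i 8).const_mul 4)
  set A := ∫ ω : ℝ, ‖ω ^ 2 * exp (-(ω ^ 4) / 2)‖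
  set B := ∫ ω : ℝ, ‖2 * (ω ^ 0 * exp (-(ω ^ 4) / 2)) - 14 * (ω ^ 4 * exp (-(ω ^ 4) / 2))
        + 4 * (ω ^ 8 * exp (-(ω ^ 4) / 2))‖
  refine (integrable_inv_one_add_sq.const_mul (1 / (2 * π) * (A + B))).mono'
    continuous_iteratedDeriv_two_phi.aestronglyMeasurable (.of_forall fun x => ?_)
  have hA : |∫ ω : ℝ, ω ^ 2 * exp (-(ω ^ 4) / 2) * cos (ω * x)| ≤ A :=
    norm_integral_le_of_norm_le (i 2).norm (.of_forall fun ω => by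
      rw [norm_mul _ (cos (ω * x))]; exact mul_le_of_le_one_right (norm_nonneg _) (abs_cos_le_one _))
  have hB : |x ^ 2 * ∫ ω : ℝ, ω ^ 2 * exp (-(ω ^ 4) / 2) * cos (ω * x)| ≤ B := by
    rw [sq_mul_integral_sq_cos, abs_neg]
    exact norm_integral_le_of_norm_le i'.norm (.of_forall fun ω => by
      rw [norm_mul _ (cos (ω * x))]; exact mul_le_of_le_one_right (norm_nonneg _) (abs_cos_le_one _))
  rw [abs_mul, abs_of_nonneg (sq_nonneg x)] at hB
  rw [iteratedDeriv_two_phi, norm_eq_abs, abs_mul, abs_neg, abs_of_pos (by positivity), mul_assoc]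
  gcongr
  rw [← div_eq_mul_inv, le_div_iff₀ (by positivity)]
  linarith

lemma integrable_Gyy (x : ℝ) {r : ℝ} (hr : 0 < r) : Integrable fun y => Gyy x y r :=
  ((integrable_iteratedDeriv_two_phi.comp_mul_right' (rpow_pos_of_pos hr _).ne').comp_sub_left
    x).const_mul _

lemma integral_abs_Gyy (x : ℝ) {r : ℝ} (hr : 0 < r) :
    ∫ y, |Gyy x y r| = r ^ (-(1 / 2) : ℝ) * ∫ z, |iteratedDeriv 2 phi z| := by
  have h := rpow_pos_of_pos hr (-(1 / 4))
  simp only [Gyy, abs_mul, abs_of_pos (rpow_pos_of_pos hr (-(3 / 4)))]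
  rw [integral_const_mul, integral_sub_left_eq_self
      (fun z => |iteratedDeriv 2 phi (z * r ^ (-(1 / 4) : ℝ))|),
    Measure.integral_comp_mul_right (fun z => |iteratedDeriv 2 phi z|),
    abs_of_pos (inv_pos.2 h), smul_eq_mul, ← mul_assoc, ← rpow_neg hr.le, ← rpow_add hr]
  norm_num

lemma abs_integral_Gyy_mul_le (x : ℝ) {r c : ℝ} (hr : 0 < r) {f : ℝ → ℝ} (hf : ∀ y, |f y| ≤ c) :
    |∫ y, Gyy x y r * f y| ≤ c * (∫ z, |iteratedDeriv 2 phi z|) * r ^ (-(1 / 2) : ℝ) := by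
  rw [← norm_eq_abs]
  refine (norm_integral_le_of_norm_le ((integrable_Gyy x hr).abs.const_mul c)
    (.of_forall fun y => ?_)).trans_eq ?_
  · rw [norm_mul, mul_comm]
    exact mul_le_mul_of_nonneg_right (hf y) (abs_nonneg _)
  · rw [integral_const_mul, integral_abs_Gyy x hr]
    ring

lemma abs_Vp_le {K a : ℝ} (ha : |a| ≤ K) : |Vp a| ≤ K ^ 3 + K := by
  refine (abs_sub _ _).trans ?_
  rw [abs_pow]
  gcongr

lemma abs_Vp_sub_le {K a b : ℝ} (ha : |a| ≤ K) (hb : |b| ≤ K) :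
    |Vp a - Vp b| ≤ (3 * K ^ 2 + 1) * |a - b| := by
  have h : Vp a - Vp b = (a ^ 2 + a * b + b ^ 2 - 1) * (a - b) := by
    unfold Vp
    ring
  rw [h, abs_mul]
  gcongr
  have := abs_le.1 ha
  have := abs_le.1 hb
  rw [abs_le]
  constructor <;> nlinarith [sq_nonneg (a + b), sq_nonneg (a - b)]

lemma intervalIntegrable_rpow_mul_exp (l t : ℝ) :
    IntervalIntegrable (fun s => (t - s) ^ (-(1 / 2) : ℝ) * exp (l * s)) volume 0 t := by
  have h := (intervalIntegral.intervalIntegrable_rpow' (a := t) (b := 0)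
    (r := -(1 / 2)) (by norm_num)).comp_sub_left t
  rw [sub_self, sub_zero] at h
  exact h.mul_continuousOn (by fun_prop)

lemma integral_rpow_mul_exp_le {l t : ℝ} (hl : 0 < l) (ht : 0 ≤ t) :
    ∫ s in (0 : ℝ)..t, (t - s) ^ (-(1 / 2) : ℝ) * exp (l * s) ≤ √(π / l) * exp (l * t) := by
  have h1 : ∫ s in (0 : ℝ)..t, (t - s) ^ (-(1 / 2) : ℝ) * exp (l * s) =
      exp (l * t) * ∫ r in (0 : ℝ)..t, r ^ ((1 / 2 : ℝ) - 1) * exp (-(l * r)) := by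
    have h := intervalIntegral.integral_comp_sub_left (a := 0) (b := t)
      (fun r => exp (l * t) * (r ^ ((1 / 2 : ℝ) - 1) * exp (-(l * r)))) t
    rw [sub_self, sub_zero] at h
    rw [← intervalIntegral.integral_const_mul, ← h]
    congr! 2 with s
    rw [mul_left_comm, ← exp_add]
    ring_nf
  have h2 : ∫ r in Set.Ioi (0 : ℝ), r ^ ((1 / 2 : ℝ) - 1) * exp (-(l * r)) = √(π / l) := by
    rw [integral_rpow_mul_exp_neg_mul_Ioi (by norm_num) hl, Gamma_one_half_eq, ← sqrt_eq_rpow,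
      ← sqrt_mul (by positivity)]
    ring_nf
  have h3 : IntegrableOn (fun r : ℝ => r ^ ((1 / 2 : ℝ) - 1) * exp (-(l * r))) (Set.Ioi 0) := by
    simpa using integrableOn_rpow_mul_exp_neg_mul_rpow (p := 1) (s := (1 / 2 : ℝ) - 1) (b := l)
      (by norm_num) one_pos hl
  rw [h1, mul_comm, ← h2, intervalIntegral.integral_of_le ht]
  refine mul_le_mul_of_nonneg_right
    (setIntegral_mono_set h3 ?_ Set.Ioc_subset_Ioi_self.eventuallyLE) (exp_pos _).le
  filter_upwards [ae_restrict_mem measurableSet_Ioi] with r hr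
  have := rpow_nonneg (le_of_lt hr) ((1 / 2 : ℝ) - 1)
  positivity

/-- The inner spatial integral of the mild formulation is integrable in time. -/
lemma intervalIntegrable_integral_Gyy_mul_Vp {T K : ℝ} {u : ℝ → ℝ → ℝ} (hT : 0 ≤ T)
    (hc : ContinuousOn (fun p : ℝ × ℝ => u p.1 p.2) (Set.univ ×ˢ Set.Icc 0 T))
    (hb : ∀ x, ∀ t ∈ Set.Icc 0 T, |u x t| ≤ K) (x : ℝ) {t : ℝ} (ht : t ∈ Set.Icc 0 T) :
    IntervalIntegrable (fun s => ∫ y, Gyy x y (t - s) * Vp (u y s)) volume 0 t := by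
  let U : ℝ × ℝ → ℝ := fun p => u p.1 (Set.projIcc 0 T hT p.2)
  have hU : Continuous U := hc.comp_continuous
    (f := fun p : ℝ × ℝ => (p.1, (Set.projIcc 0 T hT p.2 : ℝ)))
    (continuous_fst.prodMk (continuous_subtype_val.comp (continuous_projIcc.comp continuous_snd)))
    fun p => ⟨trivial, (Set.projIcc 0 T hT p.2).2⟩
  have hm : StronglyMeasurable fun s => ∫ y, Gyy x y (t - s) * Vp (U (y, s)) := by
    refine StronglyMeasurable.integral_prod_right (Measurable.stronglyMeasurable ?_)
    have hφ := continuous_iteratedDeriv_two_phi.measurable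
    have hU' := hU.measurable
    simp only [Function.uncurry_def, Gyy, Vp]
    fun_prop
  rw [intervalIntegrable_iff_integrableOn_Ioo_of_le ht.1]
  have hs : ∀ s ∈ Set.Ioo 0 t, s ∈ Set.Icc 0 T := fun s hs => ⟨hs.1.le, hs.2.le.trans ht.2⟩
  have hd := (intervalIntegrable_iff_integrableOn_Ioo_of_le ht.1).1
    (intervalIntegrable_rpow_mul_exp 0 t)
  refine (hd.const_mul ((K ^ 3 + K) * ∫ z, |iteratedDeriv 2 phi z|)).mono'
    (hm.aestronglyMeasurable.congr ?_) ?_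
  · filter_upwards [ae_restrict_mem measurableSet_Ioo] with s h
    simp only [U, Set.projIcc_of_mem hT (hs s h)]
  · filter_upwards [ae_restrict_mem measurableSet_Ioo] with s h
    simpa using abs_integral_Gyy_mul_le x (sub_pos.2 h.2) fun y => abs_Vp_le (hb y s (hs s h))

lemma integrable_Gyy_mul_Vp {T K : ℝ} {u : ℝ → ℝ → ℝ}
    (hc : ContinuousOn (fun p : ℝ × ℝ => u p.1 p.2) (Set.univ ×ˢ Set.Icc 0 T))
    (hb : ∀ x, ∀ t ∈ Set.Icc 0 T, |u x t| ≤ K) (x : ℝ) {r s : ℝ} (hr : 0 < r)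
    (hs : s ∈ Set.Icc 0 T) : Integrable fun y => Gyy x y r * Vp (u y s) := by
  have h : Continuous fun y => u y s :=
    hc.comp_continuous (f := fun y : ℝ => (y, s)) (by fun_prop) fun y => ⟨trivial, hs⟩
  refine (integrable_Gyy x hr).mul_bdd (c := K ^ 3 + K) ?_
    (.of_forall fun y => abs_Vp_le (hb y s hs))
  simp only [Vp]
  fun_prop

/-- An exponentially weighted bound on the difference of two mild solutions improves by a
factor that is small when the weight grows fast. -/
lemma IsMildSolution.abs_sub_le {T K : ℝ} {u₀ : ℝ → ℝ} {q u v : ℝ → ℝ → ℝ}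
    (hu : IsMildSolution T u₀ q u) (hv : IsMildSolution T u₀ q v)
    (hub : ∀ x, ∀ t ∈ Set.Icc 0 T, |u x t| ≤ K) (hvb : ∀ x, ∀ t ∈ Set.Icc 0 T, |v x t| ≤ K)
    {l B : ℝ} (hl : 0 < l) (hB : 0 ≤ B)
    (h : ∀ x, ∀ t ∈ Set.Ioc 0 T, |u x t - v x t| ≤ B * exp (l * t))
    (x : ℝ) {t : ℝ} (ht : t ∈ Set.Ioc 0 T) :
    |u x t - v x t| ≤
      (3 * K ^ 2 + 1) * (∫ z, |iteratedDeriv 2 phi z|) * √(π / l) * B * exp (l * t) := by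
  have ht' : t ∈ Set.Icc 0 T := ⟨ht.1.le, ht.2⟩
  have hT : 0 ≤ T := ht.1.le.trans ht.2
  set A := ∫ z, |iteratedDeriv 2 phi z|
  have hA : 0 ≤ A := integral_nonneg fun _ => abs_nonneg _
  have e : u x t - v x t = ∫ s in (0 : ℝ)..t,
      ((∫ y, Gyy x y (t - s) * Vp (u y s)) - ∫ y, Gyy x y (t - s) * Vp (v y s)) := by
    rw [intervalIntegral.integral_sub (intervalIntegrable_integral_Gyy_mul_Vp hT hu.1 hub x ht')
      (intervalIntegrable_integral_Gyy_mul_Vp hT hv.1 hvb x ht'), hu.2.2 x t ht, hv.2.2 x t ht]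
    ring
  have hbound : ∀ s ∈ Set.Ioo 0 t,
      |(∫ y, Gyy x y (t - s) * Vp (u y s)) - ∫ y, Gyy x y (t - s) * Vp (v y s)| ≤
        (3 * K ^ 2 + 1) * A * B * ((t - s) ^ (-(1 / 2) : ℝ) * exp (l * s)) := by
    intro s hs
    have hsT : s ∈ Set.Icc 0 T := ⟨hs.1.le, hs.2.le.trans ht.2⟩
    have hr := sub_pos.2 hs.2
    rw [← integral_sub (integrable_Gyy_mul_Vp hu.1 hub x hr hsT)
      (integrable_Gyy_mul_Vp hv.1 hvb x hr hsT)]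
    simp only [← mul_sub]
    refine (abs_integral_Gyy_mul_le x hr (c := (3 * K ^ 2 + 1) * (B * exp (l * s))) fun y =>
      (abs_Vp_sub_le (hub y s hsT) (hvb y s hsT)).trans ?_).trans_eq (by ring)
    gcongr
    exact h y s ⟨hs.1, hsT.2⟩
  rw [e, ← norm_eq_abs]
  refine (intervalIntegral.norm_integral_le_of_norm_le ht.1.le ?_
    ((intervalIntegrable_rpow_mul_exp l t).const_mul ((3 * K ^ 2 + 1) * A * B))).trans ?_
  · filter_upwards [Measure.ae_ne volume t] with s hs hs'
    exact hbound s ⟨hs'.1, lt_of_le_of_ne hs'.2 hs⟩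
  · rw [intervalIntegral.integral_const_mul]
    calc _ ≤ (3 * K ^ 2 + 1) * A * B * (√(π / l) * exp (l * t)) := by
          gcongr
          exact integral_rpow_mul_exp_le hl ht.1.le
      _ = _ := by ring

/-- Uniqueness: two continuous bounded solutions of the Cahn–Hilliard integral equation
on `ℝ × [0,T]` with the same data `u₀`, `q` coincide. -/
theorem uniqueness_mild_solution (T : ℝ) (hT : 0 < T)
    (u₀ : ℝ → ℝ) (hu₀c : Continuous u₀) (hu₀b : ∃ M : ℝ, ∀ x, |u₀ x| ≤ M)
    (q : ℝ → ℝ → ℝ) (hqc : Continuous (fun p : ℝ × ℝ => q p.1 p.2))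
    (hqb : ∃ M : ℝ, ∀ x t, |q x t| ≤ M)
    (u v : ℝ → ℝ → ℝ)
    (hu : IsMildSolution T u₀ q u) (hv : IsMildSolution T u₀ q v) :
    ∀ x : ℝ, ∀ t ∈ Set.Icc (0 : ℝ) T, u x t = v x t := by
  obtain ⟨Ku, hKu⟩ := hu.2.1
  obtain ⟨Kv, hKv⟩ := hv.2.1
  set K := max Ku Kv
  have hub : ∀ x, ∀ t ∈ Set.Icc 0 T, |u x t| ≤ K := fun x t ht =>
    (hKu x t ht).trans (le_max_left _ _)
  have hvb : ∀ x, ∀ t ∈ Set.Icc 0 T, |v x t| ≤ K := fun x t ht =>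
    (hKv x t ht).trans (le_max_right _ _)
  have hK : 0 ≤ K := (abs_nonneg _).trans (hub 0 0 ⟨le_rfl, hT.le⟩)
  set C := (3 * K ^ 2 + 1) * ∫ z, |iteratedDeriv 2 phi z|
  have hC : 0 ≤ C := mul_nonneg (by positivity) (integral_nonneg fun _ => abs_nonneg _)
  set l := π * (2 * (C + 1)) ^ 2
  have hl : 0 < l := by positivity
  have hCl : C * √(π / l) ≤ 1 / 2 := by
    have : π / l = (1 / (2 * (C + 1))) ^ 2 := by
      simp only [l]
      field_simp
    rw [this, sqrt_sq (by positivity), mul_one_div, div_le_div_iff₀ (by positivity) two_pos]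
    linarith
  have key : ∀ n : ℕ, ∀ x, ∀ t ∈ Set.Ioc 0 T,
      |u x t - v x t| ≤ (1 / 2) ^ n * (2 * K) * exp (l * t) := by
    intro n
    induction n with
    | zero =>
      intro x t ht
      have ht' : t ∈ Set.Icc 0 T := ⟨ht.1.le, ht.2⟩
      have h1 : 1 ≤ exp (l * t) := one_le_exp (mul_nonneg hl.le ht'.1)
      have h2 := (abs_sub (u x t) (v x t)).trans (add_le_add (hub x t ht') (hvb x t ht'))
      nlinarith
    | succ n ih =>
      intro x t ht
      refine (hu.abs_sub_le hv hub hvb hl (by positivity) ih x ht).trans ?_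
      calc _ ≤ 1 / 2 * ((1 / 2) ^ n * (2 * K)) * exp (l * t) := by gcongr
        _ = _ := by ring
  have hpos : ∀ x, ∀ t ∈ Set.Ioc 0 T, u x t = v x t := by
    intro x t ht
    have hlim : Filter.Tendsto (fun n : ℕ => (1 / 2 : ℝ) ^ n * (2 * K) * exp (l * t))
        Filter.atTop (nhds 0) := by
      simpa using ((tendsto_pow_atTop_nhds_zero_of_lt_one (r := (1 / 2 : ℝ)) (by norm_num)
        (by norm_num)).mul_const (2 * K)).mul_const (exp (l * t))
    exact sub_eq_zero.1 (abs_nonpos_iff.1 (ge_of_tendsto' hlim fun n => key n x t ht))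
  intro x
  have hcont : ∀ {w : ℝ → ℝ → ℝ}, IsMildSolution T u₀ q w → ContinuousOn (w x) (Set.Icc 0 T) :=
    fun hw => hw.1.comp (f := fun t : ℝ => (x, t)) (by fun_prop) fun t ht => ⟨trivial, ht⟩
  exact Set.EqOn.of_subset_closure (hpos x) (hcont hu) (hcont hv) Set.Ioc_subset_Icc_self
    (closure_Ioc hT.ne).ge
end
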